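/- arXiv:2301.10637 — 2 statements merged into one kernel-verified Lean document; each statement's English description precedes it below -/
import Mathlib

section
/- Let f(x) = max_{j∈[N]} log(Σ_{a∈A_j} f_{a,j} exp(aᵀx)) with finite sets A_j ⊂ ℝⁿ and positive coefficients. If f is coercive (all sublevel sets compact), then the cardinality of ∪_{j=1}^N A_j is at least n+1. -/
/-- At most `n` (and at least one) linear functionals on `ℝⁿ` are simultaneously nonpositive at some
nonzero vector. -/
theorem exists_ne_zero_forall_dotProduct_nonpos {n : ℕ} (U : Finset (Fin n → ℝ))
    (hU : U.Nonempty) (hcard : U.card ≤ n) :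
    ∃ v : Fin n → ℝ, v ≠ 0 ∧ ∀ a ∈ U, a ⬝ᵥ v ≤ 0 := by
  let L : (Fin n → ℝ) →ₗ[ℝ] (U → ℝ) :=
    Matrix.mulVecLin (Matrix.of fun (a : U) (i : Fin n) => (a : Fin n → ℝ) i)
  have hL : ∀ v (a : U), L v a = (a : Fin n → ℝ) ⬝ᵥ v := fun v a => rfl
  by_cases hsurj : Function.Surjective L
  · obtain ⟨v, hv⟩ := hsurj fun _ => -1
    have hva : ∀ a ∈ U, a ⬝ᵥ v = -1 := fun a ha => by
      rw [← hL v ⟨a, ha⟩, hv]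
    refine ⟨v, ?_, fun a ha => by rw [hva a ha]; norm_num⟩
    rintro rfl
    obtain ⟨a, ha⟩ := hU
    have := hva a ha
    simp at this
  · have hinj : ¬ Function.Injective L := fun hinj => by
      have hle := LinearMap.finrank_le_finrank_of_injective hinj
      have heq : Module.finrank ℝ (Fin n → ℝ) = Module.finrank ℝ (U → ℝ) := by
        refine le_antisymm hle ?_
        simpa using hcard
      exact hsurj ((LinearMap.injective_iff_surjective_of_finrank_eq_finrank heq).1 hinj)
    rw [injective_iff_map_eq_zero] at hinj
    push Not at hinj
    obtain ⟨v, hv, hv0⟩ := hinj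
    refine ⟨v, hv0, fun a ha => ?_⟩
    rw [← hL v ⟨a, ha⟩, hv]
    simp

/-- A set of a normed space containing a ray in a nonzero direction is not bounded. -/
theorem not_isBounded_of_forall_smul_mem {E : Type*} [NormedAddCommGroup E] [NormedSpace ℝ E]
    {s : Set E} {v : E} (hv : v ≠ 0) (h : ∀ t : ℝ, 0 ≤ t → t • v ∈ s) :
    ¬ Bornology.IsBounded s := by
  intro hs
  obtain ⟨C, hC⟩ := hs.exists_norm_le
  have hpos : 0 < ‖v‖ := norm_pos_iff.2 hv
  have hnonneg : 0 ≤ (|C| + 1) / ‖v‖ := by positivity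
  have := hC _ (h _ hnonneg)
  rw [norm_smul, Real.norm_of_nonneg hnonneg, div_mul_cancel₀ _ hpos.ne'] at this
  linarith [le_abs_self C]

theorem stmt3 {n N : ℕ} (hN : 1 ≤ N)
    (A : Fin N → Finset (Fin n → ℝ)) (hA : ∀ j, (A j).Nonempty)
    (c : Fin N → (Fin n → ℝ) → ℝ) (hc : ∀ j, ∀ a ∈ A j, 0 < c j a)
    (f : (Fin n → ℝ) → ℝ)
    (hf : ∀ x, IsGreatest
      {t | ∃ j : Fin N,
        t = Real.log (∑ a ∈ A j, c j a * Real.exp (∑ i, a i * x i))} (f x))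
    (hcoercive : ∀ t : ℝ, IsCompact {x | f x ≤ t}) :
    n + 1 ≤ (⋃ j, (A j : Set (Fin n → ℝ))).ncard := by
  classical
  have hU : (⋃ j, (A j : Set (Fin n → ℝ))) = (Finset.univ.biUnion A : Finset (Fin n → ℝ)) := by
    simp
  rw [hU, Set.ncard_coe_finset]
  by_contra! hlt
  have hne : (Finset.univ.biUnion A).Nonempty := by
    obtain ⟨a, ha⟩ := hA ⟨0, hN⟩
    exact ⟨a, Finset.mem_biUnion.2 ⟨_, Finset.mem_univ _, ha⟩⟩
  obtain ⟨v, hv0, hv⟩ :=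
    exists_ne_zero_forall_dotProduct_nonpos _ hne (Nat.lt_succ_iff.1 hlt)
  refine not_isBounded_of_forall_smul_mem hv0 (fun t ht => ?_) (hcoercive (f 0)).isBounded
  obtain ⟨j, hj⟩ := (hf (t • v)).1
  refine le_trans ?_ ((hf 0).2 ⟨j, rfl⟩)
  rw [hj]
  refine Real.log_le_log
    (Finset.sum_pos (fun a ha => mul_pos (hc j a ha) (Real.exp_pos _)) (hA j))
    (Finset.sum_le_sum fun a ha => ?_)
  refine mul_le_mul_of_nonneg_left (Real.exp_le_exp.2 ?_) (hc j a ha).le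
  change a ⬝ᵥ (t • v) ≤ a ⬝ᵥ 0
  rw [dotProduct_smul, dotProduct_zero, smul_eq_mul]
  exact mul_nonpos_of_nonneg_of_nonpos ht
    (hv a (Finset.mem_biUnion.2 ⟨j, Finset.mem_univ _, ha⟩))
end

section
/- Let A_1,…,A_N ⊂ ℤⁿ be finite nonempty sets satisfying the coercivity condition: the only x ∈ ℝⁿ with aᵀx ≤ 0 for all a ∈ ∪_j A_j is x = 0. List ∪_j A_j = {b_1,…,b_M} with ‖b_1‖₂ ≥ … ≥ ‖b_M‖₂. Then ν := min_{‖x‖_∞=1} max_k b_kᵀx satisfies ν ≥ 1/∏_{i=1}^n √(‖b_i‖₂² + 1). -/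
/-- Hadamard's inequality for the rows of a real matrix. -/
theorem Matrix.abs_det_le_prod_sqrt {n : ℕ} (B : Matrix (Fin n) (Fin n) ℝ) :
    |B.det| ≤ ∏ i, √(∑ l, B i l ^ 2) := by
  have : Fact (Module.finrank ℝ (EuclideanSpace ℝ (Fin n)) = n) := ⟨by simp⟩
  let e := EuclideanSpace.basisFun (Fin n) ℝ
  let o := e.toBasis.orientation
  have h := o.abs_volumeForm_apply_le (fun i => WithLp.toLp 2 (B i))
  rw [o.volumeForm_robust' e, Module.Basis.det_apply] at h
  convert h using 1
  · rw [← Matrix.det_transpose]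
    congr 2
  · simp [EuclideanSpace.norm_eq]

/-- A family of vectors with trivial orthogonal complement contains a basis. -/
theorem exists_injective_det_ne_zero {n : ℕ} {ι : Type*} [Finite ι] (v : ι → Fin n → ℝ)
    (hv : ∀ d : Fin n → ℝ, (∀ k, v k ⬝ᵥ d = 0) → d = 0) :
    ∃ f : Fin n → ι, Function.Injective f ∧ (Matrix.of fun i => v (f i)).det ≠ 0 := by
  have := Fintype.ofFinite ι
  have hrank : Module.finrank ℝ (Submodule.span ℝ (Set.range v)) = n := by
    have hinj : Function.Injective (Matrix.of v).mulVecLin := by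
      rw [← LinearMap.ker_eq_bot, LinearMap.ker_eq_bot']
      intro d hd
      exact hv d fun k => congrFun hd k
    have h := LinearMap.finrank_range_of_inj hinj
    rw [← Matrix.rank, Matrix.rank_eq_finrank_span_row] at h
    exact h.trans (by simp)
  obtain ⟨κ, a, ha, hspan, hli⟩ := exists_linearIndependent' ℝ v
  have := Finite.of_injective a ha
  have := Fintype.ofFinite κ
  have hcard : Fintype.card κ = n := by
    rw [← finrank_span_eq_card hli, hspan, hrank]
  let e := (Fintype.equivFinOfCardEq hcard).symm
  refine ⟨a ∘ e, ha.comp e.injective, ?_⟩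
  have hli' := hli.comp e e.injective
  rw [← isUnit_iff_ne_zero, ← Matrix.isUnit_iff_isUnit_det,
    ← Matrix.linearIndependent_rows_iff_isUnit]
  exact hli'

/-- For an antitone nonnegative family, the product over `n` distinct indices is at most the product
over the first `n` indices. -/
theorem Antitone.prod_comp_le_prod_castLE {n M : ℕ} {g : Fin M → ℝ} (hg : Antitone g)
    (hg0 : ∀ k, 0 ≤ g k) {f : Fin n → Fin M} (hf : Function.Injective f) (h : n ≤ M) :
    ∏ i, g (f i) ≤ ∏ i, g (Fin.castLE h i) := by
  have hcard : (Finset.univ.map ⟨f, hf⟩).card = n := by simp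
  let e := (Finset.univ.map ⟨f, hf⟩).orderEmbOfFin hcard
  calc ∏ i, g (f i) = ∏ k ∈ Finset.univ.map ⟨f, hf⟩, g k := by simp
    _ = ∏ i, g (e i) := by
      rw [← Finset.map_orderEmbOfFin_univ _ hcard, Finset.prod_map]; rfl
    _ ≤ _ := Finset.prod_le_prod (fun _ _ => hg0 _) fun i _ => hg ?_
  have key : ∀ j (hj : j < n), j ≤ (e ⟨j, hj⟩ : ℕ) := by
    intro j
    induction j with
    | zero => simp
    | succ j ih =>
      intro hj
      have h1 := ih (by omega)
      have h2 : e ⟨j, by omega⟩ < e ⟨j + 1, hj⟩ := e.strictMono (by simp)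
      rw [Fin.lt_def] at h2
      omega
  exact key i i.2

/-- The determinant of a real matrix with integer entries is an integer. -/
theorem Matrix.exists_intCast_det {n : ℕ} {B : Matrix (Fin n) (Fin n) ℝ}
    (hB : ∀ i j, ∃ z : ℤ, B i j = z) : ∃ z : ℤ, B.det = z := by
  choose Z hZ using hB
  refine ⟨(Matrix.of Z).det, ?_⟩
  rw [Int.cast_det]
  congr 1
  ext i j
  exact hZ i j

/-- If an integral system `B x = t • 1` is nonsingular and `|x i| = 1` for some `i`,
then `t` is bounded below in terms of the rows of `B`. -/
theorem Matrix.one_le_mul_prod_of_mulVec_eq {n : ℕ} {B : Matrix (Fin n) (Fin n) ℝ}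
    (hB : ∀ i j, ∃ z : ℤ, B i j = z) (hdet : B.det ≠ 0) {x : Fin n → ℝ} {t : ℝ} (ht : 0 ≤ t)
    (hx : B.mulVec x = fun _ => t) {i : Fin n} (hi : |x i| = 1) :
    1 ≤ t * ∏ k, √(∑ l, B k l ^ 2 + 1) := by
  have hcramer : B.det * x i = t * (B.updateCol i 1).det := by
    have h : B.cramer (B.mulVec x) i = B.det * x i := by
      rw [Matrix.cramer_eq_adjugate_mulVec, Matrix.mulVec_mulVec, Matrix.adjugate_mul]
      simp [Matrix.smul_mulVec]
    have ht1 : (fun _ => t : Fin n → ℝ) = t • 1 := by ext; simp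
    rw [← h, hx, ht1, map_smul, Pi.smul_apply, Matrix.cramer_apply, smul_eq_mul]
  have habs : |B.det| = t * |(B.updateCol i 1).det| := by
    rw [← mul_one |B.det|, ← hi, ← abs_mul, hcramer, abs_mul, abs_of_nonneg ht]
  obtain ⟨z, hz⟩ := Matrix.exists_intCast_det hB
  have hz1 : 1 ≤ |B.det| := by
    rw [hz] at hdet ⊢
    exact_mod_cast Int.one_le_abs (by exact_mod_cast hdet)
  refine hz1.trans (habs.trans_le (mul_le_mul_of_nonneg_left ?_ ht))
  refine (Matrix.abs_det_le_prod_sqrt _).trans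
    (Finset.prod_le_prod (fun _ _ => Real.sqrt_nonneg _) fun k _ => Real.sqrt_le_sqrt ?_)
  rw [← Finset.add_sum_erase _ _ (Finset.mem_univ i), add_comm]
  refine add_le_add ?_ (by simp)
  refine (Finset.sum_congr rfl fun l hl => ?_).trans_le
    (Finset.sum_le_univ_sum_of_nonneg (s := Finset.univ.erase i) fun l => sq_nonneg (B k l))
  rw [Matrix.updateCol_ne (Finset.ne_of_mem_erase hl)]

/-- Moving from a minimizer `x` along a direction `d` orthogonal to all active vectors
reaches a minimizer with strictly more active vectors. -/
theorem exists_active_ssubset {n : ℕ} {ι : Type*} [Fintype ι]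
    {v : ι → Fin n → ℝ} {t : ℝ} (hcoerc : ∀ d : Fin n → ℝ, (∀ k, v k ⬝ᵥ d ≤ 0) → d = 0)
    (ht : 0 < t) (hmin : ∀ y : Fin n → ℝ, ‖y‖ = 1 → ∃ k, t ≤ v k ⬝ᵥ y)
    {x : Fin n → ℝ} (hxt : ∀ k, v k ⬝ᵥ x ≤ t) {i : Fin n} (hi : |x i| = 1)
    {d : Fin n → ℝ} (hd : d ≠ 0) (hdi : 0 ≤ x i * d i)
    (hdx : ∀ k, v k ⬝ᵥ x = t → v k ⬝ᵥ d = 0) :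
    ∃ y : Fin n → ℝ, ‖y‖ = 1 ∧ (∀ k, v k ⬝ᵥ y ≤ t) ∧
      {k | v k ⬝ᵥ x = t} ⊂ {k | v k ⬝ᵥ y = t} := by
  have hne : (Finset.univ.filter fun k => 0 < v k ⬝ᵥ d).Nonempty := by
    by_contra h
    refine hd (hcoerc d fun k => ?_)
    by_contra hk
    exact h ⟨k, by simpa using hk⟩
  obtain ⟨k₀, hk₀, hk₀min⟩ :=
    Finset.exists_min_image _ (fun k => (t - v k ⬝ᵥ x) / (v k ⬝ᵥ d)) hne
  simp only [Finset.mem_filter, Finset.mem_univ, true_and] at hk₀ hk₀min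
  set s := (t - v k₀ ⬝ᵥ x) / (v k₀ ⬝ᵥ d) with hs
  have hs0 : 0 ≤ s := div_nonneg (sub_nonneg.2 (hxt k₀)) hk₀.le
  have hdot : ∀ k, v k ⬝ᵥ (x + s • d) = v k ⬝ᵥ x + s * (v k ⬝ᵥ d) := fun k => by
    rw [dotProduct_add, dotProduct_smul, smul_eq_mul]
  have hyt : ∀ k, v k ⬝ᵥ (x + s • d) ≤ t := by
    intro k
    rw [hdot]
    rcases le_or_gt (v k ⬝ᵥ d) 0 with h | h
    · linarith [hxt k, mul_nonpos_of_nonneg_of_nonpos hs0 h]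
    · linarith [(le_div_iff₀ h).1 (hk₀min k h)]
  have hnorm : 1 ≤ ‖x + s • d‖ := by
    have h1 : x i * x i = 1 := by rw [← abs_mul_abs_self, hi, one_mul]
    calc 1 ≤ x i * (x i + s * d i) := by nlinarith [mul_nonneg hs0 hdi]
      _ ≤ |x i * (x i + s * d i)| := le_abs_self _
      _ = |(x + s • d) i| := by rw [abs_mul, hi, one_mul]; rfl
      _ ≤ ‖x + s • d‖ := norm_le_pi_norm (x + s • d) i
  have hpos : 0 < ‖x + s • d‖ := one_pos.trans_le hnorm
  refine ⟨x + s • d, le_antisymm ?_ hnorm, hyt, ?_⟩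
  · obtain ⟨k, hk⟩ := hmin (‖x + s • d‖⁻¹ • (x + s • d)) (by
      rw [norm_smul, norm_inv, norm_norm, inv_mul_cancel₀ hpos.ne'])
    rw [dotProduct_smul, smul_eq_mul, inv_mul_eq_div, le_div_iff₀ hpos] at hk
    exact le_of_mul_le_mul_left (by linarith [hyt k]) ht
  · refine Set.ssubset_iff_of_subset (fun k hk => ?_) |>.2 ⟨k₀, ?_, fun h => hk₀.ne' (hdx k₀ h)⟩
    · have hk' : v k ⬝ᵥ x = t := hk
      simp [hdot, hk', hdx k hk']
    · change v k₀ ⬝ᵥ (x + s • d) = t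
      rw [hdot, hs, div_mul_cancel₀ _ hk₀.ne', add_sub_cancel]

/-- Some minimizer of `x ↦ maxₖ vₖᵀ x` on the unit sphere has active vectors with trivial
orthogonal complement. -/
theorem exists_active_spanning {n : ℕ} {ι : Type*} [Fintype ι]
    {v : ι → Fin n → ℝ} {t : ℝ} (hcoerc : ∀ d : Fin n → ℝ, (∀ k, v k ⬝ᵥ d ≤ 0) → d = 0)
    (ht : 0 < t) (hmin : ∀ y : Fin n → ℝ, ‖y‖ = 1 → ∃ k, t ≤ v k ⬝ᵥ y)
    {x₀ : Fin n → ℝ} (hx₀ : ‖x₀‖ = 1) (hx₀t : ∀ k, v k ⬝ᵥ x₀ ≤ t) :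
    ∃ (x : Fin n → ℝ) (i : Fin n), |x i| = 1 ∧
      ∀ d : Fin n → ℝ, (∀ k, v k ⬝ᵥ x = t → v k ⬝ᵥ d = 0) → d = 0 := by
  obtain ⟨x, ⟨hx, hxt⟩, hmax⟩ := (Set.toFinite ((fun x => {k | v k ⬝ᵥ x = t}) ''
    {x : Fin n → ℝ | ‖x‖ = 1 ∧ ∀ k, v k ⬝ᵥ x ≤ t})).exists_maximalFor' (fun x => {k | v k ⬝ᵥ x = t})
      _ ⟨x₀, hx₀, hx₀t⟩
  have : Nonempty (Fin n) := by
    by_contra h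
    rw [not_nonempty_iff] at h
    simp [Subsingleton.elim x 0] at hx
  obtain ⟨i, hi⟩ := Finite.exists_max fun i => ‖x i‖
  have hi1 : |x i| = 1 := le_antisymm (hx ▸ norm_le_pi_norm x i)
    (hx ▸ (pi_norm_le_iff_of_nonneg (norm_nonneg _)).2 hi)
  refine ⟨x, i, hi1, fun d hdx => ?_⟩
  by_contra hd
  obtain ⟨e, he, hei, hex⟩ : ∃ e : Fin n → ℝ, e ≠ 0 ∧ 0 ≤ x i * e i ∧
      ∀ k, v k ⬝ᵥ x = t → v k ⬝ᵥ e = 0 := by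
    rcases le_total 0 (x i * d i) with h | h
    · exact ⟨d, hd, h, hdx⟩
    · exact ⟨-d, neg_ne_zero.2 hd, by simpa using h, fun k hk => by simp [hdx k hk]⟩
  obtain ⟨y, hy, hyt, hxy⟩ := exists_active_ssubset hcoerc ht hmin hxt hi1 he hei hex
  exact hxy.2 (hmax ⟨hy, hyt⟩ hxy.1)

theorem stmt10 {n N M : ℕ} (hN : 1 ≤ N)
    (A : Fin N → Finset (Fin n → ℝ)) (hA : ∀ j, (A j).Nonempty)
    (hint : ∀ j, ∀ a ∈ A j, ∀ i, ∃ z : ℤ, a i = (z : ℝ))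
    (hcoerc : ∀ x : Fin n → ℝ,
      (∀ j : Fin N, ∀ a ∈ A j, (∑ i, a i * x i) ≤ 0) → x = 0)
    (b : Fin M → (Fin n → ℝ)) (hbinj : Function.Injective b)
    (hbrange : Set.range b = ⋃ j, (A j : Set (Fin n → ℝ)))
    (hsort : ∀ i k : Fin M, i ≤ k →
      Real.sqrt (∑ l, b k l ^ 2) ≤ Real.sqrt (∑ l, b i l ^ 2))
    (hM : n + 1 ≤ M)
    (m : (Fin n → ℝ) → ℝ)
    (hm : ∀ x, IsGreatest {s | ∃ k : Fin M, s = ∑ i, b k i * x i} (m x))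
    (ν : ℝ)
    (hν : IsLeast {t | ∃ x : Fin n → ℝ, ‖x‖ = 1 ∧ t = m x} ν) :
    1 / (∏ i : Fin n,
        Real.sqrt ((∑ l, b (Fin.castLE (by omega) i) l ^ 2) + 1)) ≤ ν := by
  obtain ⟨⟨x₀, hx₀, rfl⟩, hmin⟩ := hν
  have hm_le : ∀ x k, b k ⬝ᵥ x ≤ m x := fun x k => (hm x).2 ⟨k, rfl⟩
  have hcoerc' : ∀ d : Fin n → ℝ, (∀ k, b k ⬝ᵥ d ≤ 0) → d = 0 := by
    refine fun d hd => hcoerc d fun j a ha => ?_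
    have hab : a ∈ Set.range b := hbrange ▸ Set.mem_iUnion.2 ⟨j, ha⟩
    obtain ⟨k, rfl⟩ := hab
    exact hd k
  have hb_int : ∀ k i, ∃ z : ℤ, b k i = z := by
    intro k
    have hk : b k ∈ ⋃ j, (A j : Set (Fin n → ℝ)) := hbrange ▸ Set.mem_range_self k
    obtain ⟨j, hj⟩ := Set.mem_iUnion.1 hk
    exact hint j _ hj
  have hpos : 0 < m x₀ := by
    by_contra! h
    simp [hcoerc' x₀ fun k => (hm_le x₀ k).trans h] at hx₀
  have hmin' : ∀ y : Fin n → ℝ, ‖y‖ = 1 → ∃ k, m x₀ ≤ b k ⬝ᵥ y := by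
    intro y hy
    obtain ⟨k, hk⟩ := (hm y).1
    exact ⟨k, (hmin ⟨y, hy, rfl⟩).trans_eq hk⟩
  obtain ⟨x, i, hi, hspan⟩ := exists_active_spanning hcoerc' hpos hmin' hx₀ (hm_le x₀)
  obtain ⟨f, hf, hdet⟩ := exists_injective_det_ne_zero
    (fun k : {k // b k ⬝ᵥ x = m x₀} => b k) fun d hd => hspan d fun k hk => hd ⟨k, hk⟩
  have hbound := Matrix.one_le_mul_prod_of_mulVec_eq (fun _ _ => hb_int _ _) hdet hpos.le
    (funext fun k => (f k).2) hi
  have hanti : Antitone fun k => √(∑ l, b k l ^ 2 + 1) := fun i k hik =>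
    Real.sqrt_le_sqrt (by
      have := (Real.sqrt_le_sqrt_iff (Finset.sum_nonneg fun _ _ => sq_nonneg _)).1 (hsort i k hik)
      linarith)
  rw [div_le_iff₀ (Finset.prod_pos fun _ _ => by positivity)]
  exact hbound.trans (mul_le_mul_of_nonneg_left
    (hanti.prod_comp_le_prod_castLE (fun _ => Real.sqrt_nonneg _)
      (Subtype.val_injective.comp hf) (by omega)) hpos.le)
end
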